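/- (Hopf algebra structure on B.) In the depth-2 Jones tower setup, the k-algebra B carries the structure of a Hopf algebra over k, specified as follows: its comultiplication Δ : B → B ⊗_k B is the unique k-linear map satisfying ∑ F(a e₂ e₁ b₍₁₎) F(a' e₂ e₁ b₍₂₎) = λ² F(a a' e₂ e₁ b) for all a, a' ∈ A and b ∈ B (writing Δ(b) = ∑ b₍₁₎ ⊗ b₍₂₎); its counit is ε(b) := λ⁻¹F(b e₂); its antipode is the unique map S : B → B with E_{M₁}(b e₁ e₂) = E_{M₁}(e₂ e₁ S(b)) for all b ∈ B. That is: Δ and ε are k-algebra homomorphisms, Δ is coassociative with counit ε, and ∑ S(b₍₁₎) b₍₂₎ = ε(b)1 = ∑ b₍₁₎ S(b₍₂₎) for all b ∈ B. Moreover B is a semisimple ring. (By the same construction with the roles of A and B exchanged, A is also a semisimple Hopf algebra, and the non-degenerate pairing ⟨a,b⟩ = λ⁻²F(a e₂ e₁ b) exhibits A as the dual Hopf algebra of B.) -/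

import Mathlib

open scoped TensorProduct

/-- The depth-2 Jones tower setup: a tower `N ⊆ M ⊆ M₁ ⊆ R` (with `R` playing the
role of `M₂`) of unital `k`-algebras, with conditional expectations, Jones idempotents,
braid-like relations and depth-2 orthogonal dual bases, as in the paper. -/
structure JonesTower (k : Type*) [Field k] (R : Type*) [Ring R] [Algebra k R] where
  N : Subalgebra k R
  M : Subalgebra k R
  M₁ : Subalgebra k R
  hNM : N ≤ M
  hMM₁ : M ≤ M₁
  lam : k
  hlam : lam ≠ 0
  E : R →ₗ[k] R
  EM : R →ₗ[k] R
  EM1 : R →ₗ[k] R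
  hE_mem : ∀ m ∈ M, E m ∈ N
  hEM_mem : ∀ x ∈ M₁, EM x ∈ M
  hEM1_mem : ∀ x : R, EM1 x ∈ M₁
  hE_one : E 1 = 1
  hEM_one : EM 1 = 1
  hEM1_one : EM1 1 = 1
  hE_bimod : ∀ n ∈ N, ∀ n' ∈ N, ∀ m ∈ M, E (n * m * n') = n * E m * n'
  hEM_bimod : ∀ m ∈ M, ∀ m' ∈ M, ∀ x ∈ M₁, EM (m * x * m') = m * EM x * m'
  hEM1_bimod : ∀ w ∈ M₁, ∀ w' ∈ M₁, ∀ x : R, EM1 (w * x * w') = w * EM1 x * w'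
  n₀ : ℕ
  xb : Fin n₀ → R
  yb : Fin n₀ → R
  hxb : ∀ i, xb i ∈ M
  hyb : ∀ i, yb i ∈ M
  hE_dual₁ : ∀ m ∈ M, ∑ i, E (m * xb i) * yb i = m
  hE_dual₂ : ∀ m ∈ M, ∑ i, xb i * E (yb i * m) = m
  hE_index : ∑ i, xb i * yb i = lam⁻¹ • (1 : R)
  hCMN : ∀ c ∈ M, (∀ n ∈ N, c * n = n * c) → ∃ μ : k, c = μ • (1 : R)
  hCM₁M : ∀ c ∈ M₁, (∀ m ∈ M, c * m = m * c) → ∃ μ : k, c = μ • (1 : R)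
  hCM₂M₁ : ∀ c : R, (∀ w ∈ M₁, c * w = w * c) → ∃ μ : k, c = μ • (1 : R)
  e₁ : R
  e₂ : R
  he₁ : e₁ ∈ M₁
  he₁N : ∀ n ∈ N, e₁ * n = n * e₁
  he₂M : ∀ m ∈ M, e₂ * m = m * e₂
  he₁me₁ : ∀ m ∈ M, e₁ * m * e₁ = E m * e₁
  he₂we₂ : ∀ w ∈ M₁, e₂ * w * e₂ = EM w * e₂
  hEMe₁ : EM e₁ = lam • (1 : R)
  hEM1e₂ : EM1 e₂ = lam • (1 : R)
  hspanM₁ : Subalgebra.toSubmodule M₁ =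
    Submodule.span k {x : R | ∃ m ∈ M, ∃ m' ∈ M, x = m * e₁ * m'}
  hspanM₂ : (⊤ : Submodule k R) =
    Submodule.span k {x : R | ∃ w ∈ M₁, ∃ w' ∈ M₁, x = w * e₂ * w'}
  hbraid₁ : e₁ * e₂ * e₁ = lam • e₁
  hbraid₂ : e₂ * e₁ * e₂ = lam • e₂
  r : ℕ
  zb : Fin r → R
  wb : Fin r → R
  hzbM₁ : ∀ i, zb i ∈ M₁
  hwbM₁ : ∀ i, wb i ∈ M₁
  hzbN : ∀ i, ∀ n ∈ N, zb i * n = n * zb i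
  hwbN : ∀ i, ∀ n ∈ N, wb i * n = n * wb i
  hzw_orth : ∀ i j, EM (wb i * zb j) = if i = j then (1 : R) else 0
  hzw_dual₁ : ∀ x ∈ M₁, ∑ i, EM (x * zb i) * wb i = x
  hzw_dual₂ : ∀ x ∈ M₁, ∑ i, zb i * EM (wb i * x) = x
  hzw_index : ∑ i, zb i * wb i = lam⁻¹ • (1 : R)
  s : ℕ
  ub : Fin s → R
  vb : Fin s → R
  hubM : ∀ i, ∀ m ∈ M, ub i * m = m * ub i
  hvbM : ∀ i, ∀ m ∈ M, vb i * m = m * vb i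
  huv_orth : ∀ i j, EM1 (vb i * ub j) = if i = j then (1 : R) else 0
  huv_dual₁ : ∀ x : R, ∑ i, EM1 (x * ub i) * vb i = x
  huv_dual₂ : ∀ x : R, ∑ i, ub i * EM1 (vb i * x) = x
  huv_index : ∑ i, ub i * vb i = lam⁻¹ • (1 : R)
  F : R →ₗ[k] k
  hF : ∀ c : R, (∀ n ∈ N, c * n = n * c) → algebraMap k R (F c) = EM (EM1 c)

variable {k : Type*} [Field k] {R : Type*} [Ring R] [Algebra k R]

/-- The second centralizer `A = C_{M₁}(N)`. -/
def JonesTower.A (T : JonesTower k R) : Subalgebra k R :=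
  T.M₁ ⊓ Subalgebra.centralizer k (T.N : Set R)

/-- The second centralizer `B = C_{M₂}(M)`. -/
def JonesTower.B (T : JonesTower k R) : Subalgebra k R :=
  Subalgebra.centralizer k (T.M : Set R)

/-- The big centralizer `C = C_{M₂}(N)`. -/
def JonesTower.C (T : JonesTower k R) : Subalgebra k R :=
  Subalgebra.centralizer k (T.N : Set R)

/-- In a finite-dimensional convolution algebra a right antipode is also a left antipode. -/
theorem LinearMap.mul'_comp_map_id_right_of_left {H : Type*} [Ring H] [Algebra k H] [Coalgebra k H]
    [Module.Finite k H] {S : H →ₗ[k] H}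
    (h : LinearMap.mul' k H ∘ₗ TensorProduct.map LinearMap.id S ∘ₗ Coalgebra.comul =
      Algebra.linearMap k H ∘ₗ Coalgebra.counit) :
    LinearMap.mul' k H ∘ₗ TensorProduct.map S LinearMap.id ∘ₗ Coalgebra.comul =
      Algebra.linearMap k H ∘ₗ Coalgebra.counit := by
  have : Module.Finite k (WithConv (H →ₗ[k] H)) :=
    Module.Finite.equiv (WithConv.linearEquiv k (H →ₗ[k] H)).symm
  have : IsArtinianRing (WithConv (H →ₗ[k] H)) := IsArtinianRing.of_finite k _
  have h' : (WithConv.toConv LinearMap.id : WithConv (H →ₗ[k] H)) * WithConv.toConv S = 1 :=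
    congrArg WithConv.toConv h
  exact congrArg WithConv.ofConv (mul_eq_one_comm.mp h')

namespace JonesTower

variable (T : JonesTower k R)

theorem smul_one_injective [Nontrivial R] {c d : k} (h : c • (1 : R) = d • 1) : c = d :=
  (algebraMap k R).injective (by simpa [Algebra.algebraMap_eq_smul_one] using h)

theorem EM1_mul_left {w : R} (hw : w ∈ T.M₁) (x : R) : T.EM1 (w * x) = w * T.EM1 x := by
  simpa using T.hEM1_bimod w hw 1 (one_mem _) x

theorem EM1_mul_right {w : R} (hw : w ∈ T.M₁) (x : R) : T.EM1 (x * w) = T.EM1 x * w := by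
  simpa using T.hEM1_bimod 1 (one_mem _) w hw x

theorem EM1_of_mem {w : R} (hw : w ∈ T.M₁) : T.EM1 w = w := by
  simpa [T.hEM1_one] using T.EM1_mul_left hw 1

theorem smul_e₂_injective [Nontrivial R] {c d : k} (h : c • T.e₂ = d • T.e₂) : c = d := by
  have h' := congrArg T.EM1 h
  simp only [map_smul, T.hEM1e₂, smul_smul] at h'
  exact mul_right_cancel₀ T.hlam (smul_one_injective h')

theorem e₂_mul_injective {w w' : R} (hw : w ∈ T.M₁) (hw' : w' ∈ T.M₁)
    (h : T.e₂ * w = T.e₂ * w') : w = w' := by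
  have h' := congrArg T.EM1 h
  rw [T.EM1_mul_right hw, T.EM1_mul_right hw', T.hEM1e₂] at h'
  simpa [smul_right_inj T.hlam] using h'

theorem EM1_mul_e₂_mul (x : R) : T.EM1 (x * T.e₂) * T.e₂ = T.lam • (x * T.e₂) := by
  have hx : x ∈ Submodule.span k {x : R | ∃ w ∈ T.M₁, ∃ w' ∈ T.M₁, x = w * T.e₂ * w'} :=
    T.hspanM₂ ▸ Submodule.mem_top
  induction hx using Submodule.span_induction with
  | mem x h =>
    obtain ⟨w, hw, w', hw', rfl⟩ := h
    have : w * T.e₂ * w' * T.e₂ = w * T.EM w' * T.e₂ := by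
      rw [mul_assoc w, mul_assoc w, T.he₂we₂ w' hw', mul_assoc]
    rw [this, T.EM1_mul_left (mul_mem hw (T.hMM₁ (T.hEM_mem _ hw'))), T.hEM1e₂]
    simp
  | zero => simp
  | add x y _ _ hx hy => simp [add_mul, hx, hy]
  | smul c x _ hx => simp [hx, smul_comm c]

theorem e₂_mul_EM1_e₂_mul (x : R) : T.e₂ * T.EM1 (T.e₂ * x) = T.lam • (T.e₂ * x) := by
  have hx : x ∈ Submodule.span k {x : R | ∃ w ∈ T.M₁, ∃ w' ∈ T.M₁, x = w * T.e₂ * w'} :=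
    T.hspanM₂ ▸ Submodule.mem_top
  induction hx using Submodule.span_induction with
  | mem x h =>
    obtain ⟨w, hw, w', hw', rfl⟩ := h
    have : T.e₂ * (w * T.e₂ * w') = T.e₂ * (T.EM w * w') := by
      rw [← mul_assoc, ← mul_assoc, T.he₂we₂ w hw, ← T.he₂M _ (T.hEM_mem _ hw), mul_assoc]
    rw [this, T.EM1_mul_right (mul_mem (T.hMM₁ (T.hEM_mem _ hw)) hw'), T.hEM1e₂]
    simp
  | zero => simp
  | add x y _ _ hx hy => simp [mul_add, hx, hy]
  | smul c x _ hx => simp [hx, smul_comm c]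

/-- Two linear maps agree on `M₁ = M e₁ M` once they agree on its spanning elements. -/
theorem eq_on_M₁ {V : Type*} [AddCommGroup V] [Module k V] {f g : R →ₗ[k] V}
    (h : ∀ m ∈ T.M, ∀ m' ∈ T.M, f (m * T.e₁ * m') = g (m * T.e₁ * m'))
    {x : R} (hx : x ∈ T.M₁) : f x = g x := by
  have hx' : x ∈ Subalgebra.toSubmodule T.M₁ := hx
  rw [T.hspanM₁] at hx'
  refine LinearMap.eqOn_span (fun y hy => ?_) hx'
  obtain ⟨m, hm, m', hm', rfl⟩ := hy
  exact h m hm m' hm'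

theorem sum_xb_mul_e₁_mul_yb : ∑ i, T.xb i * T.e₁ * T.yb i = 1 := by
  have := T.eq_on_M₁ (f := LinearMap.mulLeft k (∑ i, T.xb i * T.e₁ * T.yb i)) (g := LinearMap.id)
    (fun m hm m' _ => ?_) (one_mem T.M₁)
  · simpa using this
  · simp only [LinearMap.mulLeft_apply, LinearMap.id_apply, Finset.sum_mul]
    conv_rhs => rw [← T.hE_dual₂ m hm]
    simp only [Finset.sum_mul]
    refine Finset.sum_congr rfl fun i _ => ?_
    calc T.xb i * T.e₁ * T.yb i * (m * T.e₁ * m')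
        = T.xb i * (T.e₁ * (T.yb i * m) * T.e₁) * m' := by noncomm_ring
      _ = _ := by rw [T.he₁me₁ _ (mul_mem (T.hyb i) hm)]; noncomm_ring

theorem sum_E_xb_mul_yb : ∑ i, T.E (T.xb i) * T.yb i = 1 := by
  simpa using T.hE_dual₁ 1 (one_mem _)

theorem sum_xb_mul_E_yb : ∑ i, T.xb i * T.E (T.yb i) = 1 := by
  simpa using T.hE_dual₂ 1 (one_mem _)

theorem B_le_C : T.B ≤ T.C := fun _ hb n hn => hb n (T.hNM hn)

theorem A_le_C : T.A ≤ T.C := fun _ ha => ha.2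

theorem e₁_mem_A : T.e₁ ∈ T.A := ⟨T.he₁, fun n hn => (T.he₁N n hn).symm⟩

theorem e₂_mem_B : T.e₂ ∈ T.B := fun m hm => (T.he₂M m hm).symm

theorem e₁_mem_C : T.e₁ ∈ T.C := T.A_le_C T.e₁_mem_A

theorem e₂_mem_C : T.e₂ ∈ T.C := T.B_le_C T.e₂_mem_B

theorem ub_mem_B (i : Fin T.s) : T.ub i ∈ T.B := fun m hm => (T.hubM i m hm).symm

theorem vb_mem_B (i : Fin T.s) : T.vb i ∈ T.B := fun m hm => (T.hvbM i m hm).symm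

theorem wb_mem_A (i : Fin T.r) : T.wb i ∈ T.A := ⟨T.hwbM₁ i, fun n hn => (T.hwbN i n hn).symm⟩

theorem EM1_mem_A {c : R} (hc : c ∈ T.C) : T.EM1 c ∈ T.A := by
  refine ⟨T.hEM1_mem c, fun n hn => ?_⟩
  have hn' := T.hMM₁ (T.hNM hn)
  rw [← T.EM1_mul_left hn', ← T.EM1_mul_right hn', hc n hn]

theorem EM_of_mem_A {a : R} (ha : a ∈ T.A) : T.EM a = T.F a • 1 := by
  have := T.hF a (fun n hn => (ha.2 n hn).symm)
  rw [T.EM1_of_mem ha.1, Algebra.algebraMap_eq_smul_one] at this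
  exact this.symm

theorem F_EM1 [Nontrivial R] {c : R} (hc : c ∈ T.C) : T.F (T.EM1 c) = T.F c := by
  apply smul_one_injective (R := R)
  rw [← T.EM_of_mem_A (T.EM1_mem_A hc), ← T.hF c (fun n hn => (hc n hn).symm),
    Algebra.algebraMap_eq_smul_one]

theorem EM1_of_mem_B [Nontrivial R] {b : R} (hb : b ∈ T.B) : T.EM1 b = T.F b • 1 := by
  obtain ⟨μ, hμ⟩ := T.hCM₁M (T.EM1 b) (T.hEM1_mem b) fun m hm => by
    rw [← T.EM1_mul_left (T.hMM₁ hm), ← T.EM1_mul_right (T.hMM₁ hm), hb m hm]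
  have h := T.hF b (fun n hn => (hb n (T.hNM hn)).symm)
  rw [hμ, map_smul, T.hEM_one, Algebra.algebraMap_eq_smul_one] at h
  rw [hμ, smul_one_injective h]

theorem eq_of_F_mul [Nontrivial R] {a a' : R} (ha : a ∈ T.A) (ha' : a' ∈ T.A)
    (h : ∀ c ∈ T.A, T.F (c * a) = T.F (c * a')) : a = a' := by
  rw [← T.hzw_dual₂ a ha.1, ← T.hzw_dual₂ a' ha'.1]
  refine Finset.sum_congr rfl fun i _ => ?_
  rw [T.EM_of_mem_A (mul_mem (T.wb_mem_A i) ha), T.EM_of_mem_A (mul_mem (T.wb_mem_A i) ha'),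
    h _ (T.wb_mem_A i)]

theorem sum_F_smul_ub [Nontrivial R] {b : R} (hb : b ∈ T.B) :
    ∑ i, T.F (T.vb i * b) • T.ub i = b := by
  conv_rhs => rw [← T.huv_dual₂ b]
  refine Finset.sum_congr rfl fun i _ => ?_
  rw [T.EM1_of_mem_B (mul_mem (T.vb_mem_B i) hb)]
  simp

theorem sum_F_smul_vb [Nontrivial R] {b : R} (hb : b ∈ T.B) :
    ∑ i, T.F (b * T.ub i) • T.vb i = b := by
  conv_rhs => rw [← T.huv_dual₁ b]
  refine Finset.sum_congr rfl fun i _ => ?_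
  rw [T.EM1_of_mem_B (mul_mem hb (T.ub_mem_B i))]
  simp

/-- The Casimir sum `∑ xᵢ c yᵢ` of an element of `C` centralizes `M`. -/
theorem sum_xb_mul_yb_mem_B {c : R} (hc : c ∈ T.C) : ∑ i, T.xb i * c * T.yb i ∈ T.B := by
  intro m hm
  rw [Finset.mul_sum, Finset.sum_mul]
  have h1 : ∀ i, m * (T.xb i * c * T.yb i) =
      ∑ j, T.xb j * c * (T.E (T.yb j * m * T.xb i) * T.yb i) := fun i => by
    calc m * (T.xb i * c * T.yb i) = (m * T.xb i) * c * T.yb i := by noncomm_ring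
      _ = (∑ j, T.xb j * T.E (T.yb j * (m * T.xb i))) * c * T.yb i := by
        rw [T.hE_dual₂ _ (mul_mem hm (T.hxb i))]
      _ = _ := by
        simp only [Finset.sum_mul]
        refine Finset.sum_congr rfl fun j _ => ?_
        have := hc _ (T.hE_mem _ (mul_mem (mul_mem (T.hyb j) hm) (T.hxb i)))
        simp only [mul_assoc] at this ⊢
        rw [← mul_assoc _ c, this]
        simp only [mul_assoc]
  rw [Finset.sum_congr rfl fun i _ => h1 i, Finset.sum_comm]
  refine Finset.sum_congr rfl fun j _ => ?_
  rw [← Finset.mul_sum, T.hE_dual₁ _ (mul_mem (T.hyb j) hm), mul_assoc, mul_assoc, mul_assoc]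

theorem F_sum_xb_mul_yb [Nontrivial R] {c : R} (hc : c ∈ T.C) :
    T.F (∑ i, T.xb i * c * T.yb i) = T.lam⁻¹ * T.F c := by
  apply smul_one_injective (R := R)
  have h := T.hF _ fun n hn => (T.B_le_C (T.sum_xb_mul_yb_mem_B hc) n hn).symm
  rw [Algebra.algebraMap_eq_smul_one] at h
  have h' := T.hF c fun n hn => (hc n hn).symm
  rw [Algebra.algebraMap_eq_smul_one] at h'
  rw [h, map_sum, map_sum]
  calc ∑ i, T.EM (T.EM1 (T.xb i * c * T.yb i)) = ∑ i, T.F c • (T.xb i * T.yb i) := by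
        refine Finset.sum_congr rfl fun i _ => ?_
        rw [T.hEM1_bimod _ (T.hMM₁ (T.hxb i)) _ (T.hMM₁ (T.hyb i)),
          T.hEM_bimod _ (T.hxb i) _ (T.hyb i) _ (T.hEM1_mem c), ← h']
        simp
    _ = _ := by rw [← Finset.smul_sum, T.hE_index, smul_smul, mul_comm]

/-- The map `b ↦ E_{M₁}(e₂ e₁ b)`. -/
def toA : R →ₗ[k] R := T.EM1 ∘ₗ LinearMap.mulLeft k (T.e₂ * T.e₁)

/-- The map `b ↦ E_{M₁}(b e₁ e₂)`. -/
def toA' : R →ₗ[k] R := T.EM1 ∘ₗ LinearMap.mulRight k (T.e₁ * T.e₂)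

/-- The map `a ↦ λ⁻² ∑ xᵢ e₁ e₂ a yᵢ`, inverse to `toA` on the centralizers. -/
def ofA : R →ₗ[k] R :=
  T.lam⁻¹ ^ 2 • ∑ i, LinearMap.mulRight k (T.yb i) ∘ₗ LinearMap.mulLeft k (T.xb i * T.e₁ * T.e₂)

/-- The map `a ↦ λ⁻² ∑ xᵢ a e₂ e₁ yᵢ`, a right inverse to `toA'` on the centralizers. -/
def ofA' : R →ₗ[k] R :=
  T.lam⁻¹ ^ 2 • ∑ i, LinearMap.mulRight k (T.e₂ * T.e₁ * T.yb i) ∘ₗ LinearMap.mulLeft k (T.xb i)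

theorem toA_apply (b : R) : T.toA b = T.EM1 (T.e₂ * T.e₁ * b) := rfl

theorem toA'_apply (b : R) : T.toA' b = T.EM1 (b * T.e₁ * T.e₂) := by
  simp [toA', mul_assoc]

theorem ofA_apply (a : R) :
    T.ofA a = T.lam⁻¹ ^ 2 • ∑ i, T.xb i * (T.e₁ * T.e₂ * a) * T.yb i := by
  simp [ofA, mul_assoc]

theorem ofA'_apply (a : R) :
    T.ofA' a = T.lam⁻¹ ^ 2 • ∑ i, T.xb i * (a * T.e₂ * T.e₁) * T.yb i := by
  simp [ofA', mul_assoc]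

theorem toA_mem {b : R} (hb : b ∈ T.C) : T.toA b ∈ T.A :=
  T.EM1_mem_A (mul_mem (mul_mem T.e₂_mem_C T.e₁_mem_C) hb)

theorem toA'_mem {b : R} (hb : b ∈ T.C) : T.toA' b ∈ T.A := by
  rw [toA'_apply]
  exact T.EM1_mem_A (mul_mem (mul_mem hb T.e₁_mem_C) T.e₂_mem_C)

theorem ofA_mem {a : R} (ha : a ∈ T.A) : T.ofA a ∈ T.B := by
  rw [ofA_apply]
  exact T.B.smul_mem (T.sum_xb_mul_yb_mem_B
    (mul_mem (mul_mem T.e₁_mem_C T.e₂_mem_C) (T.A_le_C ha))) _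

theorem ofA'_mem {a : R} (ha : a ∈ T.A) : T.ofA' a ∈ T.B := by
  rw [ofA'_apply]
  exact T.B.smul_mem (T.sum_xb_mul_yb_mem_B
    (mul_mem (mul_mem (T.A_le_C ha) T.e₂_mem_C) T.e₁_mem_C)) _

theorem e₂_mul_toA (b : R) : T.e₂ * T.toA b = T.lam • (T.e₂ * T.e₁ * b) := by
  rw [toA_apply, mul_assoc, e₂_mul_EM1_e₂_mul]

theorem toA'_mul_e₂ (b : R) : T.toA' b * T.e₂ = T.lam • (b * T.e₁ * T.e₂) := by
  rw [toA'_apply, EM1_mul_e₂_mul]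

theorem toA'_mul_e₂_mul_e₁ (b : R) : T.toA' b * T.e₂ * T.e₁ = T.lam ^ 2 • (b * T.e₁) := by
  rw [toA'_mul_e₂, smul_mul_assoc, mul_assoc, mul_assoc, ← mul_assoc T.e₁, T.hbraid₁,
    mul_smul_comm, smul_smul, sq]

theorem ofA_toA {b : R} (hb : b ∈ T.B) : T.ofA (T.toA b) = b := by
  have h : ∀ i, T.xb i * (T.e₁ * T.e₂ * T.toA b) * T.yb i =
      T.lam ^ 2 • (T.xb i * T.e₁ * T.yb i * b) := fun i => by
    rw [mul_assoc T.e₁, e₂_mul_toA, mul_smul_comm, ← mul_assoc, ← mul_assoc, T.hbraid₁]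
    simp only [smul_mul_assoc, mul_smul_comm, smul_smul, mul_assoc, ← hb _ (T.hyb i), sq]
  rw [ofA_apply, Finset.sum_congr rfl fun i _ => h i, ← Finset.smul_sum, ← Finset.sum_mul,
    T.sum_xb_mul_e₁_mul_yb, smul_smul, ← mul_pow, inv_mul_cancel₀ T.hlam]
  simp

theorem toA_ofA {a : R} (ha : a ∈ T.A) : T.toA (T.ofA a) = a := by
  have h : ∀ i, T.EM1 (T.e₂ * T.e₁ * (T.xb i * (T.e₁ * T.e₂ * a) * T.yb i)) =
      T.lam ^ 2 • (a * (T.E (T.xb i) * T.yb i)) := fun i => by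
    have hE := T.hE_mem _ (T.hxb i)
    have hM := T.hMM₁ (T.hyb i)
    calc T.EM1 (T.e₂ * T.e₁ * (T.xb i * (T.e₁ * T.e₂ * a) * T.yb i))
        = T.EM1 (T.e₂ * (T.e₁ * T.xb i * T.e₁) * T.e₂ * (a * T.yb i)) := by noncomm_ring
      _ = T.EM1 (T.E (T.xb i) * (T.e₂ * T.e₁ * T.e₂) * (a * T.yb i)) := by
        rw [T.he₁me₁ _ (T.hxb i)]
        simp only [← mul_assoc]
        rw [T.he₂M _ (T.hNM hE)]
      _ = T.lam ^ 2 • (T.E (T.xb i) * a * T.yb i) := by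
        rw [T.hbraid₂, T.hEM1_bimod _ (T.hMM₁ (T.hNM hE)) _ (mul_mem ha.1 hM), map_smul, T.hEM1e₂]
        simp [smul_smul, sq, mul_assoc]
      _ = _ := by rw [ha.2 _ hE, mul_assoc]
  rw [toA_apply, ofA_apply, mul_smul_comm, map_smul, Finset.mul_sum, map_sum,
    Finset.sum_congr rfl fun i _ => h i, ← Finset.smul_sum, ← Finset.mul_sum,
    T.sum_E_xb_mul_yb, smul_smul, ← mul_pow, inv_mul_cancel₀ T.hlam]
  simp

theorem toA'_ofA' {a : R} (ha : a ∈ T.A) : T.toA' (T.ofA' a) = a := by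
  have h : ∀ i, T.EM1 (T.xb i * (a * T.e₂ * T.e₁) * T.yb i * T.e₁ * T.e₂) =
      T.lam ^ 2 • (T.xb i * T.E (T.yb i) * a) := fun i => by
    have hE := T.hE_mem _ (T.hyb i)
    have hM := T.hMM₁ (T.hxb i)
    calc T.EM1 (T.xb i * (a * T.e₂ * T.e₁) * T.yb i * T.e₁ * T.e₂)
        = T.EM1 (T.xb i * a * T.e₂ * (T.e₁ * T.yb i * T.e₁) * T.e₂) := by noncomm_ring
      _ = T.EM1 (T.xb i * a * T.E (T.yb i) * (T.e₂ * T.e₁ * T.e₂)) := by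
        rw [T.he₁me₁ _ (T.hyb i)]
        simp only [mul_assoc]
        rw [← mul_assoc T.e₂ (T.E _), T.he₂M _ (T.hNM hE)]
        simp only [mul_assoc]
      _ = T.lam ^ 2 • (T.xb i * (a * T.E (T.yb i))) := by
        rw [T.hbraid₂, T.EM1_mul_left (mul_mem (mul_mem hM ha.1) (T.hMM₁ (T.hNM hE))), map_smul,
          T.hEM1e₂]
        simp [smul_smul, sq, mul_assoc]
      _ = _ := by rw [← ha.2 _ hE, mul_assoc]
  rw [toA'_apply, ofA'_apply]
  simp only [smul_mul_assoc, map_smul, Finset.sum_mul, map_sum]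
  rw [Finset.sum_congr rfl fun i _ => h i, ← Finset.smul_sum, ← Finset.sum_mul,
    T.sum_xb_mul_E_yb, smul_smul, ← mul_pow, inv_mul_cancel₀ T.hlam]
  simp

theorem F_mul_e₁_mul [Nontrivial R] {v b : R} (hv : v ∈ T.B) (hb : b ∈ T.B) :
    T.F (v * T.e₁ * b) = T.lam * T.F (v * b) := by
  have h := T.F_sum_xb_mul_yb (mul_mem (mul_mem (T.B_le_C hv) T.e₁_mem_C) (T.B_le_C hb))
  have h' : ∀ i, T.xb i * (v * T.e₁ * b) * T.yb i = v * (T.xb i * T.e₁ * T.yb i) * b := fun i => by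
    simp only [← mul_assoc]
    rw [hv _ (T.hxb i), mul_assoc _ b, ← hb _ (T.hyb i)]
    simp only [mul_assoc]
  rw [Finset.sum_congr rfl fun i _ => h' i, ← Finset.sum_mul, ← Finset.mul_sum,
    T.sum_xb_mul_e₁_mul_yb, mul_one] at h
  rw [h, mul_inv_cancel_left₀ T.hlam]

theorem F_mul_toA [Nontrivial R] {a c : R} (ha : a ∈ T.A) (hc : c ∈ T.C) :
    T.F (a * T.toA c) = T.F (a * T.e₂ * T.e₁ * c) := by
  rw [toA_apply, ← T.EM1_mul_left ha.1, T.F_EM1]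
  · simp only [mul_assoc]
  · exact mul_mem (T.A_le_C ha) (mul_mem (mul_mem T.e₂_mem_C T.e₁_mem_C) hc)

theorem F_toA'_mul (v c : R) :
    T.F (T.toA' v * T.e₂ * T.e₁ * c) = T.lam ^ 2 * T.F (v * T.e₁ * c) := by
  rw [toA'_mul_e₂_mul_e₁]
  simp

theorem F_toA'_mul_of_mem_B [Nontrivial R] {v b : R} (hv : v ∈ T.B) (hb : b ∈ T.B) :
    T.F (T.toA' v * T.e₂ * T.e₁ * b) = T.lam ^ 3 * T.F (v * b) := by
  rw [T.F_toA'_mul, T.F_mul_e₁_mul hv hb]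
  ring

/-- The right action `x ◁ b = λ⁻¹ E_{M₁}(e₂ x b)` of `B` on `M₁`. -/
def ract (x b : R) : R := T.lam⁻¹ • T.EM1 (T.e₂ * x * b)

/-- The left action `b ▷ x = λ⁻¹ E_{M₁}(b x e₂)` of `B` on `M₁`. -/
def lact (b x : R) : R := T.lam⁻¹ • T.EM1 (b * x * T.e₂)

theorem e₂_mul_ract (x b : R) : T.e₂ * T.ract x b = T.e₂ * x * b := by
  rw [ract, mul_smul_comm, mul_assoc T.e₂, e₂_mul_EM1_e₂_mul, smul_smul, inv_mul_cancel₀ T.hlam,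
    one_smul]

theorem lact_mul_e₂ (b x : R) : T.lact b x * T.e₂ = b * x * T.e₂ := by
  rw [lact, smul_mul_assoc, EM1_mul_e₂_mul, smul_smul, inv_mul_cancel₀ T.hlam, one_smul]

theorem ract_mem_M₁ (x b : R) : T.ract x b ∈ T.M₁ := T.M₁.smul_mem (T.hEM1_mem _) _

theorem lact_mem_M₁ (b x : R) : T.lact b x ∈ T.M₁ := T.M₁.smul_mem (T.hEM1_mem _) _

theorem ract_mem_A {x b : R} (hx : x ∈ T.A) (hb : b ∈ T.B) : T.ract x b ∈ T.A :=
  T.A.smul_mem (T.EM1_mem_A (mul_mem (mul_mem T.e₂_mem_C (T.A_le_C hx)) (T.B_le_C hb))) _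

theorem lact_mem_A {x b : R} (hx : x ∈ T.A) (hb : b ∈ T.B) : T.lact b x ∈ T.A :=
  T.A.smul_mem (T.EM1_mem_A (mul_mem (mul_mem (T.B_le_C hb) (T.A_le_C hx)) T.e₂_mem_C)) _

theorem ract_e₁ (b : R) : T.ract T.e₁ b = T.lam⁻¹ • T.toA b := rfl

theorem lact_e₁ (b : R) : T.lact b T.e₁ = T.lam⁻¹ • T.toA' b := by
  rw [toA'_apply, lact]

theorem ract_mul (x b c : R) : T.ract x (b * c) = T.ract (T.ract x b) c := by
  refine T.e₂_mul_injective (T.ract_mem_M₁ _ _) (T.ract_mem_M₁ _ _) ?_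
  simp only [e₂_mul_ract, mul_assoc]

theorem ract_bimod {m m' x b : R} (hm : m ∈ T.M) (hm' : m' ∈ T.M) (hb : b ∈ T.B) :
    T.ract (m * x * m') b = m * T.ract x b * m' := by
  have h : T.e₂ * (m * x * m') * b = m * (T.e₂ * x * b) * m' := by
    simp only [← mul_assoc]
    rw [T.he₂M m hm, mul_assoc _ b, ← hb _ hm', ← mul_assoc]
  rw [ract, ract, h, T.hEM1_bimod _ (T.hMM₁ hm) _ (T.hMM₁ hm')]
  simp

theorem lact_bimod {m m' x b : R} (hm : m ∈ T.M) (hm' : m' ∈ T.M) (hb : b ∈ T.B) :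
    T.lact b (m * x * m') = m * T.lact b x * m' := by
  have h : b * (m * x * m') * T.e₂ = m * (b * x * T.e₂) * m' := by
    simp only [← mul_assoc]
    rw [hb m hm, mul_assoc _ T.e₂, T.he₂M _ hm', ← mul_assoc]
  rw [lact, lact, h, T.hEM1_bimod _ (T.hMM₁ hm) _ (T.hMM₁ hm')]
  simp

/-- The antipode `b ↦ toA⁻¹ (toA' b)`. -/
def antipode : T.B →ₗ[k] T.B :=
  (T.ofA ∘ₗ T.toA' ∘ₗ T.B.val.toLinearMap).codRestrict (Subalgebra.toSubmodule T.B)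
    fun b => T.ofA_mem (T.toA'_mem (T.B_le_C b.2))

theorem toA_antipode (b : T.B) : T.toA (T.antipode b : R) = T.toA' (b : R) :=
  T.toA_ofA (T.toA'_mem (T.B_le_C b.2))

theorem toA_injOn {b c : R} (hb : b ∈ T.B) (hc : c ∈ T.B) (h : T.toA b = T.toA c) : b = c := by
  rw [← T.ofA_toA hb, ← T.ofA_toA hc, h]

theorem lact_eq_ract_antipode (b : T.B) {x : R} (hx : x ∈ T.M₁) :
    T.lact b x = T.ract x (T.antipode b) := by
  refine T.eq_on_M₁
    (f := T.lam⁻¹ • T.EM1 ∘ₗ LinearMap.mulRight k T.e₂ ∘ₗ LinearMap.mulLeft k (b : R))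
    (g := T.lam⁻¹ • T.EM1 ∘ₗ LinearMap.mulRight k (T.antipode b : R) ∘ₗ LinearMap.mulLeft k T.e₂)
    (fun m hm m' hm' => ?_) hx
  change T.lact b (m * T.e₁ * m') = T.ract (m * T.e₁ * m') (T.antipode b)
  rw [T.lact_bimod hm hm' b.2, T.ract_bimod hm hm' (T.antipode b).2, lact_e₁, ract_e₁, toA_antipode]

/-- Invariance of `E_M` under exchanging the two actions. -/
theorem F_ract_mul [Nontrivial R] {x y b : R} (hx : x ∈ T.A) (hy : y ∈ T.A) (hb : b ∈ T.B) :
    T.F (T.ract x b * y) = T.F (x * T.lact b y) := by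
  apply T.smul_e₂_injective
  have h1 : T.e₂ * (T.ract x b * y) * T.e₂ = T.F (T.ract x b * y) • T.e₂ := by
    rw [T.he₂we₂ _ (mul_mem (T.ract_mem_M₁ x b) hy.1),
      T.EM_of_mem_A (mul_mem (T.ract_mem_A hx hb) hy), smul_mul_assoc, one_mul]
  have h2 : T.e₂ * (x * T.lact b y) * T.e₂ = T.F (x * T.lact b y) • T.e₂ := by
    rw [T.he₂we₂ _ (mul_mem hx.1 (T.lact_mem_M₁ b y)),
      T.EM_of_mem_A (mul_mem hx (T.lact_mem_A hy hb)), smul_mul_assoc, one_mul]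
  rw [← h1, ← h2, ← mul_assoc, e₂_mul_ract]
  simp only [mul_assoc, lact_mul_e₂]

/-- The counit `b ↦ λ⁻¹ F (b e₂)` on `R`. -/
def counitAux (b : R) : k := T.lam⁻¹ * T.F (b * T.e₂)

theorem mul_e₂_of_mem_B [Nontrivial R] {b : R} (hb : b ∈ T.B) :
    b * T.e₂ = T.counitAux b • T.e₂ := by
  have h := T.EM1_mul_e₂_mul b
  rw [T.EM1_of_mem_B (mul_mem hb T.e₂_mem_B)] at h
  rw [counitAux, mul_smul, ← one_mul T.e₂, ← mul_assoc, ← smul_mul_assoc (T.F _), mul_one, h,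
    smul_smul, inv_mul_cancel₀ T.hlam, one_smul]

theorem F_ract [Nontrivial R] {x b : R} (hx : x ∈ T.A) (hb : b ∈ T.B) :
    T.F (T.ract x b) = T.counitAux b * T.F x := by
  apply T.smul_e₂_injective
  have h1 : T.e₂ * T.ract x b * T.e₂ = T.F (T.ract x b) • T.e₂ := by
    rw [T.he₂we₂ _ (T.ract_mem_M₁ x b), T.EM_of_mem_A (T.ract_mem_A hx hb), smul_mul_assoc, one_mul]
  rw [← h1, e₂_mul_ract, mul_assoc, T.mul_e₂_of_mem_B hb, mul_smul_comm, T.he₂we₂ _ hx.1,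
    T.EM_of_mem_A hx, smul_mul_assoc, one_mul, smul_smul]

theorem F_e₂_mul_e₁_mul [Nontrivial R] {b : R} (hb : b ∈ T.B) :
    T.F (T.e₂ * T.e₁ * b) = T.lam ^ 2 * T.counitAux b := by
  rw [← T.F_EM1 (mul_mem (mul_mem T.e₂_mem_C T.e₁_mem_C) (T.B_le_C hb)), ← toA_apply]
  have h := T.F_ract T.e₁_mem_A hb
  rw [ract_e₁, map_smul, smul_eq_mul] at h
  have h' : T.F T.e₁ = T.lam := by
    apply smul_one_injective (R := R)
    rw [← T.hEMe₁, T.EM_of_mem_A T.e₁_mem_A]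
  rw [h'] at h
  calc _ = T.lam * (T.lam⁻¹ * T.F (T.toA b)) := by rw [mul_inv_cancel_left₀ T.hlam]
    _ = _ := by rw [h]; ring

/-- The functional `b ↦ F (a e₂ e₁ b)` on `B`. -/
abbrev pairing (a : R) : T.B →ₗ[k] k :=
  (T.F ∘ₗ LinearMap.mulLeft k (a * T.e₂ * T.e₁)) ∘ₗ T.B.val.toLinearMap

theorem eq_of_pairing_eq [Nontrivial R] {b c : T.B}
    (h : ∀ a ∈ T.A, T.pairing a b = T.pairing a c) : b = c := by
  refine Subtype.ext (T.toA_injOn b.2 c.2 (T.eq_of_F_mul (T.toA_mem (T.B_le_C b.2))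
    (T.toA_mem (T.B_le_C c.2)) fun a ha => ?_))
  rw [T.F_mul_toA ha (T.B_le_C b.2), T.F_mul_toA ha (T.B_le_C c.2)]
  exact h a ha

/-- The dual basis elements `uᵢ` as elements of `B`. -/
def uB (i : Fin T.s) : T.B := ⟨T.ub i, T.ub_mem_B i⟩

theorem sum_F_smul_uB [Nontrivial R] (b : T.B) : ∑ i, T.F (T.vb i * b) • T.uB i = b := by
  apply Subtype.ext
  rw [AddSubmonoidClass.coe_finsetSum]
  exact T.sum_F_smul_ub b.2

theorem finite_B [Nontrivial R] : Module.Finite k T.B := by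
  refine Module.Finite.of_surjective (Fintype.linearCombination k T.uB) fun b => ?_
  exact ⟨fun i => T.F (T.vb i * b), by
    rw [Fintype.linearCombination_apply, T.sum_F_smul_uB]⟩

theorem eq_sum_pairing_tmul [Nontrivial R] {V : Type*} [AddCommGroup V] [Module k V]
    (t : T.B ⊗[k] V) :
    t = ∑ i, T.uB i ⊗ₜ (T.lam⁻¹ ^ 3 •
      TensorProduct.lid k V ((T.pairing (T.toA' (T.vb i))).rTensor V t)) := by
  induction t using TensorProduct.induction_on with
  | zero => simp
  | add s t hs ht =>
    conv_lhs => rw [hs, ht]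
    simp only [map_add, smul_add, TensorProduct.tmul_add, Finset.sum_add_distrib]
  | tmul b v =>
    conv_lhs => rw [← T.sum_F_smul_uB b]
    rw [TensorProduct.sum_tmul]
    refine Finset.sum_congr rfl fun i _ => ?_
    have : T.pairing (T.toA' (T.vb i)) b = T.lam ^ 3 * T.F (T.vb i * b) :=
      T.F_toA'_mul_of_mem_B (T.vb_mem_B i) b.2
    rw [LinearMap.rTensor_tmul, TensorProduct.lid_tmul, this, smul_smul, ← mul_assoc, ← mul_pow,
      inv_mul_cancel₀ T.hlam, one_pow, one_mul, TensorProduct.smul_tmul]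

theorem eq_of_rTensor_pairing_eq [Nontrivial R] {V : Type*} [AddCommGroup V] [Module k V]
    {t t' : T.B ⊗[k] V}
    (h : ∀ a ∈ T.A, TensorProduct.lid k V ((T.pairing a).rTensor V t) =
      TensorProduct.lid k V ((T.pairing a).rTensor V t')) : t = t' := by
  rw [T.eq_sum_pairing_tmul t, T.eq_sum_pairing_tmul t']
  refine Finset.sum_congr rfl fun i _ => ?_
  rw [h _ (T.toA'_mem (T.B_le_C (T.vb_mem_B i)))]

/-- The functional `f ⊗ g` on a tensor product, with values in `k`. -/
abbrev tensorFunctional {V W : Type*} [AddCommGroup V] [Module k V] [AddCommGroup W] [Module k W]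
    (f : V →ₗ[k] k) (g : W →ₗ[k] k) : V ⊗[k] W →ₗ[k] k :=
  (TensorProduct.lid k k).toLinearMap ∘ₗ TensorProduct.map f g

theorem tensorFunctional_eq {V W : Type*} [AddCommGroup V] [Module k V] [AddCommGroup W]
    [Module k W] (f : V →ₗ[k] k) (g : W →ₗ[k] k) (t : V ⊗[k] W) :
    tensorFunctional f g t = g (TensorProduct.lid k W (f.rTensor W t)) := by
  have : tensorFunctional f g = g ∘ₗ (TensorProduct.lid k W).toLinearMap ∘ₗ f.rTensor W := by
    ext; simp
  rw [this]; rfl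

theorem eq_of_pairing_tensor_eq [Nontrivial R] {t t' : T.B ⊗[k] T.B}
    (h : ∀ a ∈ T.A, ∀ a' ∈ T.A, tensorFunctional (T.pairing a) (T.pairing a') t =
      tensorFunctional (T.pairing a) (T.pairing a') t') : t = t' :=
  T.eq_of_rTensor_pairing_eq fun a ha => T.eq_of_pairing_eq fun a' ha' => by
    rw [← tensorFunctional_eq, ← tensorFunctional_eq, h a ha a' ha']

theorem eq_of_pairing_tensor_tensor_eq [Nontrivial R] {t t' : T.B ⊗[k] (T.B ⊗[k] T.B)}
    (h : ∀ a ∈ T.A, ∀ a' ∈ T.A, ∀ a'' ∈ T.A,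
      tensorFunctional (T.pairing a) (tensorFunctional (T.pairing a') (T.pairing a'')) t =
      tensorFunctional (T.pairing a) (tensorFunctional (T.pairing a') (T.pairing a'')) t') :
    t = t' :=
  T.eq_of_rTensor_pairing_eq fun a ha => T.eq_of_pairing_tensor_eq fun a' ha' a'' ha'' => by
    rw [← tensorFunctional_eq, ← tensorFunctional_eq, h a ha a' ha' a'' ha'']

/-- The right action of `b` as a linear endomorphism of `R`, depending linearly on `b`. -/
def ractHom : T.B →ₗ[k] R →ₗ[k] R :=
  LinearMap.mk₂ k (fun b x => T.ract x b)
    (fun b c x => by simp [ract, mul_add]) (fun c b x => by simp [ract, smul_comm c])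
    (fun b x y => by simp [ract, mul_add, add_mul]) (fun c b x => by simp [ract, smul_comm c])

/-- The map `p ⊗ q ↦ (y ↦ q (y ◁ p))`. -/
def tensorAct : T.B ⊗[k] T.B →ₗ[k] R →ₗ[k] R :=
  TensorProduct.lift
    ((LinearMap.llcomp k R R R).flip ∘ₗ T.ractHom |>.compl₂
      ((LinearMap.mul k R) ∘ₗ T.B.val.toLinearMap))

theorem tensorAct_tmul (p q : T.B) (y : R) : T.tensorAct (p ⊗ₜ q) y = q * T.ract y p := rfl

/-- The map `c ↦ λ ∑ᵢ toA⁻¹ (E_{M₁}(vᵢ c)) ⊗ uᵢ`, with the first leg expanded in the basis `uⱼ`. -/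
def toTensor : R →ₗ[k] T.B ⊗[k] T.B :=
  T.lam • ∑ i, ∑ j, LinearMap.toSpanSingleton k _ (T.uB j ⊗ₜ[k] T.uB i) ∘ₗ T.F ∘ₗ
    LinearMap.mulLeft k (T.vb j) ∘ₗ T.ofA ∘ₗ T.EM1 ∘ₗ LinearMap.mulLeft k (T.vb i)

theorem toTensor_apply (c : R) : T.toTensor c = T.lam • ∑ i, ∑ j,
    T.F (T.vb j * T.ofA (T.EM1 (T.vb i * c))) • (T.uB j ⊗ₜ[k] T.uB i) := by
  simp [toTensor]

theorem toTensor_tensorAct_e₁ [Nontrivial R] (t : T.B ⊗[k] T.B) :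
    T.toTensor (T.tensorAct t T.e₁) = t := by
  induction t using TensorProduct.induction_on with
  | zero => simp
  | add s t hs ht => simp [hs, ht]
  | tmul p q =>
    have h : ∀ i, T.ofA (T.EM1 (T.vb i * (q * T.ract T.e₁ p))) =
        (T.lam⁻¹ * T.F (T.vb i * q)) • (p : R) := fun i => by
      rw [← mul_assoc, T.EM1_mul_right (T.ract_mem_M₁ _ _),
        T.EM1_of_mem_B (mul_mem (T.vb_mem_B i) q.2), smul_mul_assoc, one_mul, ract_e₁, smul_smul,
        map_smul, T.ofA_toA p.2, mul_comm]
    rw [toTensor_apply, tensorAct_tmul]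
    simp only [h, mul_smul_comm, map_smul, smul_eq_mul]
    have h2 : ∀ i, ∑ j, (T.lam⁻¹ * T.F (T.vb i * q) * T.F (T.vb j * p)) •
        (T.uB j ⊗ₜ[k] T.uB i) = p ⊗ₜ[k] (T.lam⁻¹ • T.F (T.vb i * q) • T.uB i) := fun i => by
      conv_rhs => rw [← T.sum_F_smul_uB p]
      rw [TensorProduct.sum_tmul]
      refine Finset.sum_congr rfl fun j _ => ?_
      simp only [TensorProduct.tmul_smul, TensorProduct.smul_tmul', smul_smul]
    rw [Finset.sum_congr rfl fun i _ => h2 i, ← TensorProduct.tmul_sum, ← Finset.smul_sum,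
      T.sum_F_smul_uB, TensorProduct.tmul_smul, smul_smul, mul_inv_cancel₀ T.hlam, one_smul]

theorem tensorAct_toTensor [Nontrivial R] {c : R} (hc : c ∈ T.C) :
    T.tensorAct (T.toTensor c) T.e₁ = c := by
  rw [toTensor_apply]
  simp only [map_smul, map_sum, LinearMap.smul_apply, LinearMap.sum_apply, tensorAct_tmul]
  conv_rhs => rw [← T.huv_dual₂ c]
  rw [Finset.smul_sum]
  refine Finset.sum_congr rfl fun i _ => ?_
  have hA := T.EM1_mem_A (mul_mem (T.B_le_C (T.vb_mem_B i)) hc)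
  conv_rhs => rw [← T.toA_ofA hA, ← T.sum_F_smul_ub (T.ofA_mem hA)]
  rw [map_sum, Finset.mul_sum, Finset.smul_sum]
  refine Finset.sum_congr rfl fun j _ => ?_
  rw [ract_e₁, map_smul, mul_smul_comm, mul_smul_comm, smul_comm, smul_smul, smul_smul, mul_assoc,
    mul_inv_cancel₀ T.hlam, mul_one]
  rfl

/-- The comultiplication `b ↦ λ ∑ᵢ toA⁻¹ (E_{M₁}(vᵢ e₁ b)) ⊗ uᵢ`. -/
def comulLin : T.B →ₗ[k] T.B ⊗[k] T.B :=
  T.toTensor ∘ₗ LinearMap.mulLeft k T.e₁ ∘ₗ T.B.val.toLinearMap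

theorem tensorAct_bimod (t : T.B ⊗[k] T.B) {m m' : R} (hm : m ∈ T.M) (hm' : m' ∈ T.M) (x : R) :
    T.tensorAct t (m * x * m') = m * T.tensorAct t x * m' := by
  induction t using TensorProduct.induction_on with
  | zero => simp
  | add s t hs ht => simp [hs, ht, mul_add, add_mul]
  | tmul p q =>
    rw [tensorAct_tmul, tensorAct_tmul, T.ract_bimod hm hm' p.2]
    simp only [← mul_assoc]
    rw [q.2 m hm]

theorem tensorAct_comulLin [Nontrivial R] (b : T.B) {y : R} (hy : y ∈ T.M₁) :
    T.tensorAct (T.comulLin b) y = y * b := by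
  refine T.eq_on_M₁ (g := LinearMap.mulRight k (b : R)) (fun m hm m' hm' => ?_) hy
  have h : T.tensorAct (T.comulLin b) T.e₁ = T.e₁ * b :=
    T.tensorAct_toTensor (mul_mem T.e₁_mem_C (T.B_le_C b.2))
  rw [T.tensorAct_bimod _ hm hm', h, LinearMap.mulRight_apply, mul_assoc, mul_assoc T.e₁,
    ← b.2 _ hm']
  simp only [mul_assoc]

theorem tensorAct_mul_comulLin [Nontrivial R] (s : T.B ⊗[k] T.B) (b : T.B) (y : R) :
    T.tensorAct (s * T.comulLin b) y = T.tensorAct s y * b := by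
  induction s using TensorProduct.induction_on with
  | zero => simp
  | add s t hs ht => simp [hs, ht, add_mul]
  | tmul p q =>
    have h : ∀ t : T.B ⊗[k] T.B, T.tensorAct ((p ⊗ₜ q) * t) y = q * T.tensorAct t (T.ract y p) := by
      intro t
      induction t using TensorProduct.induction_on with
      | zero => simp
      | add s t hs ht => simp [hs, ht, mul_add]
      | tmul p' q' =>
        rw [Algebra.TensorProduct.tmul_mul_tmul, tensorAct_tmul, tensorAct_tmul,
          MulMemClass.coe_mul, MulMemClass.coe_mul, ract_mul, mul_assoc]
    rw [h, T.tensorAct_comulLin b (T.ract_mem_M₁ _ _), tensorAct_tmul, mul_assoc]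

theorem comulLin_mul [Nontrivial R] (b c : T.B) :
    T.comulLin (b * c) = T.comulLin b * T.comulLin c := by
  rw [← T.toTensor_tensorAct_e₁ (T.comulLin b * T.comulLin c),
    T.tensorAct_mul_comulLin, T.tensorAct_comulLin _ T.he₁, mul_assoc]
  rfl

theorem ract_one {x : R} (hx : x ∈ T.M₁) : T.ract x 1 = x :=
  T.e₂_mul_injective (T.ract_mem_M₁ _ _) hx (by rw [e₂_mul_ract, mul_one])

theorem comulLin_one [Nontrivial R] : T.comulLin 1 = 1 := by
  rw [← T.toTensor_tensorAct_e₁ 1, Algebra.TensorProduct.one_def, tensorAct_tmul,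
    OneMemClass.coe_one, T.ract_one T.he₁, one_mul]
  simp [comulLin]

/-- The comultiplication as an algebra homomorphism. -/
def comulHom [Nontrivial R] : T.B →ₐ[k] T.B ⊗[k] T.B :=
  AlgHom.ofLinearMap T.comulLin T.comulLin_one T.comulLin_mul

theorem counitAux_mul [Nontrivial R] {b c : R} (hb : b ∈ T.B) (hc : c ∈ T.B) :
    T.counitAux (b * c) = T.counitAux b * T.counitAux c := by
  apply T.smul_e₂_injective
  rw [← T.mul_e₂_of_mem_B (mul_mem hb hc), mul_assoc, T.mul_e₂_of_mem_B hc, mul_smul_comm,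
    T.mul_e₂_of_mem_B hb, smul_smul, mul_comm]

theorem counitAux_one [Nontrivial R] : T.counitAux 1 = 1 := by
  apply T.smul_e₂_injective
  rw [← T.mul_e₂_of_mem_B (one_mem _), one_mul, one_smul]

/-- The counit as an algebra homomorphism. -/
def counitHom [Nontrivial R] : T.B →ₐ[k] k :=
  AlgHom.ofLinearMap (T.lam⁻¹ • T.F ∘ₗ LinearMap.mulRight k T.e₂ ∘ₗ T.B.val.toLinearMap)
    T.counitAux_one fun b c => T.counitAux_mul b.2 c.2

theorem counitHom_apply [Nontrivial R] (b : T.B) : T.counitHom b = T.counitAux b := rfl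

theorem pairing_one [Nontrivial R] : T.pairing 1 = T.lam ^ 2 • T.counitHom.toLinearMap := by
  ext b
  change T.F (1 * T.e₂ * T.e₁ * b) = T.lam ^ 2 * T.counitAux b
  rw [one_mul, T.F_e₂_mul_e₁_mul b.2]

theorem F_mul_mul_tensorAct [Nontrivial R] {a v : R} (ha : a ∈ T.A) (hv : v ∈ T.B)
    (t : T.B ⊗[k] T.B) : tensorFunctional (T.pairing a) (T.pairing (T.toA' v)) t =
      T.lam ^ 4 * T.F (a * v * T.tensorAct t T.e₁) := by
  induction t using TensorProduct.induction_on with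
  | zero => simp
  | add s t hs ht => simp only [map_add, hs, ht, LinearMap.add_apply, mul_add]
  | tmul p q =>
    have h1 : T.pairing (T.toA' v) q = T.lam ^ 3 * T.F (v * q) := T.F_toA'_mul_of_mem_B hv q.2
    have h2 : T.pairing a p = T.lam * T.F (a * T.ract T.e₁ p) := by
      rw [ract_e₁, mul_smul_comm, map_smul, smul_eq_mul, mul_inv_cancel_left₀ T.hlam,
        T.F_mul_toA ha (T.B_le_C p.2)]
      rfl
    have hr := T.ract_mem_A T.e₁_mem_A p.2
    have h3 : T.F (a * v * (q * T.ract T.e₁ p)) = T.F (v * q) * T.F (a * T.ract T.e₁ p) := by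
      have hvq := mul_mem hv q.2
      have : a * v * (q * T.ract T.e₁ p) = a * (v * q * T.ract T.e₁ p) := by noncomm_ring
      rw [this, ← T.F_EM1 (mul_mem (T.A_le_C ha) (mul_mem (T.B_le_C hvq) (T.A_le_C hr))),
        T.EM1_mul_left ha.1, T.EM1_mul_right hr.1, T.EM1_of_mem_B hvq]
      simp
    change T.pairing a p * T.pairing (T.toA' v) q = _
    rw [h1, h2, tensorAct_tmul, h3]
    ring

theorem pairing_comulLin [Nontrivial R] {a a' : R} (ha : a ∈ T.A) (ha' : a' ∈ T.A) :
    tensorFunctional (T.pairing a) (T.pairing a') ∘ₗ T.comulLin =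
      T.lam ^ 2 • T.pairing (a * a') := by
  ext b
  rw [← T.toA'_ofA' ha']
  change tensorFunctional _ _ (T.comulLin b) = T.lam ^ 2 * T.F (_ * T.e₂ * T.e₁ * b)
  rw [T.F_mul_mul_tensorAct ha (T.ofA'_mem ha'), T.tensorAct_comulLin _ T.he₁]
  have : a * T.toA' (T.ofA' a') * T.e₂ * T.e₁ * b =
      T.lam ^ 2 • (a * T.ofA' a' * (T.e₁ * b)) := by
    rw [mul_assoc a, mul_assoc a, toA'_mul_e₂_mul_e₁]
    simp [mul_assoc]
  rw [this, map_smul, smul_eq_mul]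
  ring

theorem coassoc [Nontrivial R] :
    (TensorProduct.assoc k T.B T.B T.B).toLinearMap ∘ₗ
        TensorProduct.map T.comulLin LinearMap.id ∘ₗ T.comulLin =
      TensorProduct.map LinearMap.id T.comulLin ∘ₗ T.comulLin := by
  ext1 b
  refine T.eq_of_pairing_tensor_tensor_eq fun a ha a' ha' a'' ha'' => ?_
  have h1 : tensorFunctional (T.pairing a) (tensorFunctional (T.pairing a') (T.pairing a'')) ∘ₗ
      (TensorProduct.assoc k T.B T.B T.B).toLinearMap ∘ₗ
        TensorProduct.map T.comulLin LinearMap.id =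
      tensorFunctional (tensorFunctional (T.pairing a) (T.pairing a') ∘ₗ T.comulLin)
        (T.pairing a'') := by
    have : tensorFunctional (T.pairing a) (tensorFunctional (T.pairing a') (T.pairing a'')) ∘ₗ
      (TensorProduct.assoc k T.B T.B T.B).toLinearMap =
      tensorFunctional (tensorFunctional (T.pairing a) (T.pairing a')) (T.pairing a'') := by
      ext; simp [mul_assoc]
    rw [← LinearMap.comp_assoc, this]
    ext; simp
  have h2 : tensorFunctional (T.pairing a) (tensorFunctional (T.pairing a') (T.pairing a'')) ∘ₗ
        TensorProduct.map LinearMap.id T.comulLin =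
      tensorFunctional (T.pairing a)
        (tensorFunctional (T.pairing a') (T.pairing a'') ∘ₗ T.comulLin) := by
    ext; simp
  have h3 : ∀ (c : k) (f g : T.B →ₗ[k] k), tensorFunctional (c • f) g = c • tensorFunctional f g :=
    fun c f g => by ext; simp [mul_assoc]
  have h4 : ∀ (c : k) (f g : T.B →ₗ[k] k), tensorFunctional f (c • g) = c • tensorFunctional f g :=
    fun c f g => by ext; simp [mul_left_comm]
  refine (LinearMap.congr_fun h1 (T.comulLin b)).trans (.trans ?_
    (LinearMap.congr_fun h2 (T.comulLin b)).symm)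
  rw [T.pairing_comulLin ha ha', T.pairing_comulLin ha' ha'', h3, h4, LinearMap.smul_apply,
    LinearMap.smul_apply]
  have h5 := LinearMap.congr_fun (T.pairing_comulLin (mul_mem ha ha') ha'') b
  have h6 := LinearMap.congr_fun (T.pairing_comulLin ha (mul_mem ha' ha'')) b
  rw [LinearMap.comp_apply] at h5 h6
  rw [h5, h6, mul_assoc a]

theorem map_counit_id_comp_comulLin [Nontrivial R] :
    (TensorProduct.lid k T.B).toLinearMap ∘ₗ
        TensorProduct.map T.counitHom.toLinearMap LinearMap.id ∘ₗ T.comulLin = LinearMap.id := by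
  ext1 b
  refine T.eq_of_pairing_eq fun a ha => ?_
  have h1 : T.pairing a ∘ₗ (TensorProduct.lid k T.B).toLinearMap ∘ₗ
      TensorProduct.map T.counitHom.toLinearMap LinearMap.id =
      T.lam⁻¹ ^ 2 • tensorFunctional (T.pairing 1) (T.pairing a) := by
    rw [pairing_one]
    ext
    simp [T.hlam, ← mul_assoc]
  refine (LinearMap.congr_fun h1 (T.comulLin b)).trans ?_
  have h2 := LinearMap.congr_fun (T.pairing_comulLin (one_mem _) ha) b
  rw [LinearMap.comp_apply] at h2
  rw [LinearMap.smul_apply, h2, one_mul, LinearMap.smul_apply, smul_smul, ← mul_pow,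
    inv_mul_cancel₀ T.hlam, one_pow, one_smul]
  rfl

theorem map_id_counit_comp_comulLin [Nontrivial R] :
    (TensorProduct.rid k T.B).toLinearMap ∘ₗ
        TensorProduct.map LinearMap.id T.counitHom.toLinearMap ∘ₗ T.comulLin = LinearMap.id := by
  ext1 b
  refine T.eq_of_pairing_eq fun a ha => ?_
  have h1 : T.pairing a ∘ₗ (TensorProduct.rid k T.B).toLinearMap ∘ₗ
      TensorProduct.map LinearMap.id T.counitHom.toLinearMap =
      T.lam⁻¹ ^ 2 • tensorFunctional (T.pairing a) (T.pairing 1) := by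
    rw [pairing_one]
    ext
    simp [mul_left_comm, mul_comm, mul_inv_cancel_left₀ (pow_ne_zero 2 T.hlam)]
  refine (LinearMap.congr_fun h1 (T.comulLin b)).trans ?_
  have h2 := LinearMap.congr_fun (T.pairing_comulLin ha (one_mem _)) b
  rw [LinearMap.comp_apply] at h2
  rw [LinearMap.smul_apply, h2, mul_one, LinearMap.smul_apply, smul_smul, ← mul_pow,
    inv_mul_cancel₀ T.hlam, one_pow, one_smul]
  rfl

/-- The coalgebra structure on `B`. -/
abbrev coalgebra [Nontrivial R] : Coalgebra k T.B where
  comul := T.comulLin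
  counit := T.counitHom.toLinearMap
  coassoc := T.coassoc
  rTensor_counit_comp_comul := by
    ext1 b
    apply (TensorProduct.lid k T.B).injective
    simpa [LinearMap.rTensor] using LinearMap.congr_fun T.map_counit_id_comp_comulLin b
  lTensor_counit_comp_comul := by
    ext1 b
    apply (TensorProduct.rid k T.B).injective
    simpa [LinearMap.lTensor] using LinearMap.congr_fun T.map_id_counit_comp_comulLin b

theorem F_ract_tensorAct [Nontrivial R] {x y : R} (hx : x ∈ T.A) (hy : y ∈ T.A)
    (t : T.B ⊗[k] T.B) : T.F (T.ract x (T.tensorAct t y)) =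
      T.F (x * T.ract y (LinearMap.mul' k T.B (TensorProduct.map LinearMap.id T.antipode t) :
        T.B)) := by
  induction t using TensorProduct.induction_on with
  | zero => simp [ract]
  | add s t hs ht =>
    have h : ∀ z b c : R, T.ract z (b + c) = T.ract z b + T.ract z c := fun z b c => by
      simp [ract, mul_add]
    simp only [map_add, LinearMap.add_apply, h, hs, ht, AddMemClass.coe_add, mul_add]
  | tmul p q =>
    have hp := T.ract_mem_A hy p.2
    have h : T.ract x (q * T.ract y p) = T.ract x q * T.ract y p := by
      rw [ract, ← mul_assoc, T.EM1_mul_right hp.1, ← smul_mul_assoc, ← ract]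
    rw [tensorAct_tmul, h, T.F_ract_mul hx hp q.2, T.lact_eq_ract_antipode q hp.1, ← ract_mul]
    simp

theorem mul'_comp_map_id_antipode [Nontrivial R] :
    LinearMap.mul' k T.B ∘ₗ TensorProduct.map LinearMap.id T.antipode ∘ₗ T.comulLin =
      Algebra.linearMap k T.B ∘ₗ T.counitHom.toLinearMap := by
  ext1 b
  set s := LinearMap.mul' k T.B (TensorProduct.map LinearMap.id T.antipode (T.comulLin b)) with hs
  change s = algebraMap k T.B (T.counitHom b)
  have hA : T.ract T.e₁ s = T.counitAux b • T.e₁ := by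
    refine T.eq_of_F_mul (T.ract_mem_A T.e₁_mem_A s.2) (T.A.smul_mem T.e₁_mem_A _) fun x hx => ?_
    rw [hs, ← T.F_ract_tensorAct hx T.e₁_mem_A, T.tensorAct_comulLin b T.he₁]
    have : T.ract x (T.e₁ * b) = T.ract (x * T.e₁) b := by simp only [ract, mul_assoc]
    rw [this, T.F_ract (mul_mem hx T.e₁_mem_A) b.2, mul_smul_comm, map_smul, smul_eq_mul]
  refine Subtype.ext (T.toA_injOn s.2 (algebraMap k T.B (T.counitHom b)).2 ?_)
  have h1 := T.ract_one T.he₁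
  rw [ract_e₁] at hA h1
  rw [Subalgebra.coe_algebraMap, Algebra.algebraMap_eq_smul_one, map_smul, counitHom_apply]
  have h2 := congrArg (T.lam • ·) hA
  have h3 := congrArg (T.lam • ·) h1
  simp only [smul_smul, mul_inv_cancel₀ T.hlam, one_smul] at h2 h3
  rw [h2, h3, smul_smul, mul_comm]

theorem mul'_comp_map_antipode_id [Nontrivial R] :
    LinearMap.mul' k T.B ∘ₗ TensorProduct.map T.antipode LinearMap.id ∘ₗ T.comulLin =
      Algebra.linearMap k T.B ∘ₗ T.counitHom.toLinearMap :=
  letI := T.coalgebra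
  haveI := T.finite_B
  LinearMap.mul'_comp_map_id_right_of_left T.mul'_comp_map_id_antipode

theorem sum_ub_apply_vb_mul [Nontrivial R] {V : Type*} [AddCommGroup V] [Module k V]
    [Module T.B V] [IsScalarTower k T.B V] (f : T.B →ₗ[k] V) (b : T.B) :
    ∑ i, T.uB i • f (⟨T.vb i, T.vb_mem_B i⟩ * b) =
      b • ∑ i, T.uB i • f ⟨T.vb i, T.vb_mem_B i⟩ := by
  have h : ∀ i, (⟨T.vb i, T.vb_mem_B i⟩ * b : T.B) =
      ∑ j, T.F (T.vb i * (b * T.ub j)) • ⟨T.vb j, T.vb_mem_B j⟩ := fun i => by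
    apply Subtype.ext
    rw [AddSubmonoidClass.coe_finsetSum]
    have := T.sum_F_smul_vb (mul_mem (T.vb_mem_B i) b.2)
    simp only [mul_assoc] at this
    exact this.symm
  simp only [h, map_sum, map_smul, Finset.smul_sum]
  rw [Finset.sum_comm]
  refine Finset.sum_congr rfl fun j _ => ?_
  have h2 := T.sum_F_smul_uB (b * T.uB j)
  rw [← mul_smul, ← h2, Finset.sum_smul]
  refine Finset.sum_congr rfl fun i _ => ?_
  rw [smul_assoc, ← algebraMap_smul T.B (T.F _) (f _), ← algebraMap_smul T.B (T.F _) (_ • f _),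
    ← mul_smul, ← mul_smul, Algebra.commutes]
  rfl

theorem isSemisimpleRing_B [Nontrivial R] : IsSemisimpleRing T.B := by
  refine { exists_isCompl := fun I => ?_ }
  obtain ⟨p, hp⟩ := (I.subtype.restrictScalars k).exists_leftInverse_of_injective
    (LinearMap.ker_eq_bot.mpr I.injective_subtype)
  let π : T.B →ₗ[T.B] I :=
    { toFun := fun x => T.lam • ∑ i, T.uB i • p (⟨T.vb i, T.vb_mem_B i⟩ * x)
      map_add' := fun x y => by simp only [mul_add, map_add, smul_add, Finset.sum_add_distrib]
      map_smul' := fun b x => by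
        have := T.sum_ub_apply_vb_mul (p ∘ₗ LinearMap.mulRight k x) b
        simp only [LinearMap.comp_apply, LinearMap.mulRight_apply, mul_assoc] at this
        rw [smul_eq_mul, this, RingHom.id_apply, smul_comm] }
  refine ⟨LinearMap.ker π, LinearMap.isCompl_of_proj fun x => ?_⟩
  have h : ∀ i, p (⟨T.vb i, T.vb_mem_B i⟩ * (x : T.B)) = (⟨T.vb i, T.vb_mem_B i⟩ : T.B) • x :=
    fun i => LinearMap.congr_fun hp ((⟨T.vb i, T.vb_mem_B i⟩ : T.B) • x)
  change T.lam • ∑ i, T.uB i • p (⟨T.vb i, T.vb_mem_B i⟩ * (x : T.B)) = x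
  have h2 : ∑ i, T.uB i * ⟨T.vb i, T.vb_mem_B i⟩ = T.lam⁻¹ • (1 : T.B) := by
    apply Subtype.ext
    rw [AddSubmonoidClass.coe_finsetSum]
    exact T.huv_index
  simp only [h, ← mul_smul]
  rw [← Finset.sum_smul, h2, smul_assoc, smul_smul, mul_inv_cancel₀ T.hlam, one_smul, one_smul]

end JonesTower

/-- **Hopf algebra structure on `B`.** The centralizer `B = C_{M₂}(M)` carries the
structure of a semisimple Hopf algebra over `k`: there are algebra homomorphisms
`Δ : B → B ⊗ₖ B` (the unique map satisfying
`∑ F(a e₂ e₁ b₍₁₎) F(a' e₂ e₁ b₍₂₎) = λ² F(a a' e₂ e₁ b)` for all `a, a' ∈ A`,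
where the left side is the pairing applied to `Δ(b)`), `ε : B → k`,
`ε(b) = λ⁻¹ F(b e₂)`, and a linear map `S : B → B` (the unique map with
`E_{M₁}(b e₁ e₂) = E_{M₁}(e₂ e₁ S(b))`), such that `Δ` is coassociative with
counit `ε` and `S` satisfies the antipode axioms; moreover `B` is a semisimple
ring. -/
theorem hopf_algebra_structure_on_B (T : JonesTower k R) [Nontrivial R] :
    ∃ (Δ : ↥T.B →ₐ[k] (↥T.B ⊗[k] ↥T.B)) (ε : ↥T.B →ₐ[k] k) (S : ↥T.B →ₗ[k] ↥T.B),
      -- Δ is determined by the non-degenerate pairing with A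
      (∀ b : ↥T.B, ∀ a ∈ T.A, ∀ a' ∈ T.A,
        (TensorProduct.lid k k)
          (TensorProduct.map
            ((T.F ∘ₗ LinearMap.mulLeft k (a * T.e₂ * T.e₁)) ∘ₗ T.B.val.toLinearMap)
            ((T.F ∘ₗ LinearMap.mulLeft k (a' * T.e₂ * T.e₁)) ∘ₗ T.B.val.toLinearMap)
            (Δ b)) =
          T.lam ^ 2 * T.F (a * a' * T.e₂ * T.e₁ * (b : R))) ∧
      (∀ Δ' : ↥T.B →ₗ[k] (↥T.B ⊗[k] ↥T.B),
        (∀ b : ↥T.B, ∀ a ∈ T.A, ∀ a' ∈ T.A,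
          (TensorProduct.lid k k)
            (TensorProduct.map
              ((T.F ∘ₗ LinearMap.mulLeft k (a * T.e₂ * T.e₁)) ∘ₗ T.B.val.toLinearMap)
              ((T.F ∘ₗ LinearMap.mulLeft k (a' * T.e₂ * T.e₁)) ∘ₗ T.B.val.toLinearMap)
              (Δ' b)) =
            T.lam ^ 2 * T.F (a * a' * T.e₂ * T.e₁ * (b : R))) →
        Δ' = Δ.toLinearMap) ∧
      -- the counit is ε(b) = λ⁻¹ F(b e₂)
      (∀ b : ↥T.B, ε b = T.lam⁻¹ * T.F ((b : R) * T.e₂)) ∧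
      -- the antipode is characterized by E_{M₁}(b e₁ e₂) = E_{M₁}(e₂ e₁ S(b))
      (∀ b : ↥T.B, T.EM1 ((b : R) * T.e₁ * T.e₂) = T.EM1 (T.e₂ * T.e₁ * (S b : R))) ∧
      (∀ S' : ↥T.B → ↥T.B,
        (∀ b : ↥T.B, T.EM1 ((b : R) * T.e₁ * T.e₂) = T.EM1 (T.e₂ * T.e₁ * (S' b : R))) →
        S' = ⇑S) ∧
      -- coassociativity
      ((TensorProduct.assoc k ↥T.B ↥T.B ↥T.B).toLinearMap ∘ₗ
          TensorProduct.map Δ.toLinearMap LinearMap.id ∘ₗ Δ.toLinearMap =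
        TensorProduct.map LinearMap.id Δ.toLinearMap ∘ₗ Δ.toLinearMap) ∧
      -- counit axioms
      ((TensorProduct.lid k ↥T.B).toLinearMap ∘ₗ
          TensorProduct.map ε.toLinearMap LinearMap.id ∘ₗ Δ.toLinearMap =
        LinearMap.id) ∧
      ((TensorProduct.rid k ↥T.B).toLinearMap ∘ₗ
          TensorProduct.map LinearMap.id ε.toLinearMap ∘ₗ Δ.toLinearMap =
        LinearMap.id) ∧
      -- antipode axioms: ∑ S(b₍₁₎) b₍₂₎ = ε(b) 1 = ∑ b₍₁₎ S(b₍₂₎)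
      (LinearMap.mul' k ↥T.B ∘ₗ TensorProduct.map S LinearMap.id ∘ₗ Δ.toLinearMap =
        Algebra.linearMap k ↥T.B ∘ₗ ε.toLinearMap) ∧
      (LinearMap.mul' k ↥T.B ∘ₗ TensorProduct.map LinearMap.id S ∘ₗ Δ.toLinearMap =
        Algebra.linearMap k ↥T.B ∘ₗ ε.toLinearMap) ∧
      IsSemisimpleRing ↥T.B := by
  refine ⟨T.comulHom, T.counitHom, T.antipode, fun b a ha a' ha' => ?_, fun Δ' h => ?_,
    fun _ => rfl, fun b => ?_, fun S' h => ?_, T.coassoc, T.map_counit_id_comp_comulLin,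
    T.map_id_counit_comp_comulLin, T.mul'_comp_map_antipode_id, T.mul'_comp_map_id_antipode,
    T.isSemisimpleRing_B⟩
  · exact LinearMap.congr_fun (T.pairing_comulLin ha ha') b
  · ext1 b
    exact T.eq_of_pairing_tensor_eq fun a ha a' ha' =>
      (h b a ha a' ha').trans (LinearMap.congr_fun (T.pairing_comulLin ha ha') b).symm
  · rw [← T.toA'_apply, ← T.toA_apply, T.toA_antipode]
  · funext b
    refine Subtype.ext (T.toA_injOn (S' b).2 (T.antipode b).2 ?_)
    rw [T.toA_antipode, T.toA'_apply, T.toA_apply, h b]
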